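/- Let 0 < p < 1. There exists a constant c_p > 0, depending only on p and λ = sup_k m_k, such that for every martingale f ∈ H_p the strong convergence (Hardy-type) inequality Σ_{k=1}^∞ ‖S_k f‖_{L_p(μ)}^p / k^{2−p} ≤ c_p · ‖f‖_{H_p}^p holds. -/

import Mathlib

open MeasureTheory Complex Finset
open scoped BigOperators ENNReal NNReal

noncomputable section

instance (n : ℕ) : MeasurableSpace (ZMod n) := ⊤

/-- The Vilenkin group determined by the generating sequence `m`. -/
abbrev Gm (m : ℕ → ℕ) : Type := ∀ _k : ℕ, ZMod (m _k)

namespace Vilenkin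

variable (m : ℕ → ℕ)

/-- The generalized powers `M_0 = 1`, `M_{k+1} = m_k · M_k`. -/
def M : ℕ → ℕ
  | 0 => 1
  | k + 1 => m k * M k

/-- The `j`-th digit `n_j` of `n` in the generalized number system based on `m`. -/
def digit (n j : ℕ) : ℕ := n / M m j % m j

/-- `|n|`, the index of the highest nonzero digit of `n`. -/
def hi (n : ℕ) : ℕ := Nat.findGreatest (fun j => digit m n j ≠ 0) n

/-- `⟨n⟩`, the index of the lowest nonzero digit of `n`. -/
def lo (n : ℕ) : ℕ := sInf {j | digit m n j ≠ 0}

/-- The generalized Rademacher functions `r_k(x) = exp(2πi x_k / m_k)`. -/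
def rad (k : ℕ) (x : Gm m) : ℂ :=
  Complex.exp (2 * Real.pi * Complex.I * ((x k).val : ℂ) / (m k : ℂ))

/-- The Vilenkin functions `ψ_n = ∏_k r_k^{n_k}`. -/
def vil (n : ℕ) (x : Gm m) : ℂ :=
  ∏ k ∈ Finset.range (n + 1), rad m k x ^ digit m n k

/-- The Dirichlet kernels `D_n = ∑_{k=0}^{n-1} ψ_k`. -/
def D (n : ℕ) (x : Gm m) : ℂ := ∑ k ∈ Finset.range n, vil m k x

/-- The Fejér kernels `K_n = (1/n) ∑_{k=1}^{n} D_k`. -/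
def K (n : ℕ) (x : Gm m) : ℂ := (n : ℂ)⁻¹ * ∑ k ∈ Finset.range n, D m (k + 1) x

/-- The Nörlund kernels `F_n = (1/Q_n) ∑_{k=1}^{n} q_{n-k} D_k` where
`Q_n = ∑_{k=0}^{n-1} q_k`. -/
def FK (q : ℕ → ℝ) (n : ℕ) (x : Gm m) : ℂ :=
  ((∑ k ∈ Finset.range n, q k : ℝ) : ℂ)⁻¹ *
    ∑ k ∈ Finset.range n, (q (n - (k + 1)) : ℂ) * D m (k + 1) x

/-- The cylinder subgroup `I_n = {x : x_0 = … = x_{n-1} = 0}`. -/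
def I (n : ℕ) : Set (Gm m) := {x | ∀ k < n, x k = 0}

/-- The cylinder of length `n` around `x`. -/
def cylAt (n : ℕ) (x : Gm m) : Set (Gm m) := {y | ∀ k < n, y k = x k}

/-- `μ` is the normalized Haar measure of `G_m`: the (unique) Borel probability
measure giving each cylinder of length `n` measure `1 / M_n`. -/
def IsHaar (μ : Measure (Gm m)) : Prop :=
  ∀ (n : ℕ) (x : Gm m), μ (cylAt m n x) = (M m n : ℝ≥0∞)⁻¹

/-- A martingale with respect to the filtration `(ℱ_n)` on `G_m`, where `ℱ_n` is
generated by the first `n` coordinates: each `f n` is integrable and depends only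
on the first `n` coordinates, and the conditional expectation of `f N` with
respect to `ℱ_n` (which under the Haar measure is given by averaging over the
cylinders of length `n`) equals `f n` for `n ≤ N`. -/
structure IsMartingale (μ : Measure (Gm m)) (f : ℕ → Gm m → ℂ) : Prop where
  integrable : ∀ n, Integrable (f n) μ
  adapted : ∀ (n : ℕ) (x y : Gm m), (∀ k < n, x k = y k) → f n x = f n y
  mart : ∀ n N : ℕ, n ≤ N → ∀ x : Gm m,
    f n x = (M m n : ℂ) * ∫ t in cylAt m n x, f N t ∂μ

/-- The Vilenkin–Fourier coefficients of a martingale: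
`f̂(i) = lim_k ∫ f^(k) conj(ψ_i) dμ`; for a martingale these integrals are
constant as soon as `M_k > i`, in particular from `k = i + 1` on. -/
def coeff (μ : Measure (Gm m)) (f : ℕ → Gm m → ℂ) (i : ℕ) : ℂ :=
  ∫ x, f (i + 1) x * (starRingEnd ℂ) (vil m i x) ∂μ

/-- The partial sums `S_n f = ∑_{k=0}^{n-1} f̂(k) ψ_k`. -/
def S (μ : Measure (Gm m)) (f : ℕ → Gm m → ℂ) (n : ℕ) (x : Gm m) : ℂ :=
  ∑ k ∈ Finset.range n, coeff m μ f k * vil m k x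

/-- The Fejér means `σ_n f = (1/n) ∑_{k=1}^{n} S_k f`. -/
def sigma (μ : Measure (Gm m)) (f : ℕ → Gm m → ℂ) (n : ℕ) (x : Gm m) : ℂ :=
  (n : ℂ)⁻¹ * ∑ k ∈ Finset.range n, S m μ f (k + 1) x

/-- The Nörlund means `t_n f = (1/Q_n) ∑_{k=1}^{n} q_{n-k} S_k f`. -/
def T (μ : Measure (Gm m)) (q : ℕ → ℝ) (f : ℕ → Gm m → ℂ) (n : ℕ) (x : Gm m) : ℂ :=
  ((∑ k ∈ Finset.range n, q k : ℝ) : ℂ)⁻¹ *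
    ∑ k ∈ Finset.range n, (q (n - (k + 1)) : ℂ) * S m μ f (k + 1) x

/-- The martingale maximal function `f* = sup_n |f^(n)|`. -/
def mstar (f : ℕ → Gm m → ℂ) (x : Gm m) : ℝ≥0∞ := ⨆ n, (‖f n x‖₊ : ℝ≥0∞)

/-- The `L_p`-type quasi-norm `(∫ g^p dμ)^{1/p}` of an `ℝ≥0∞`-valued function. -/
def eLp (μ : Measure (Gm m)) (p : ℝ) (g : Gm m → ℝ≥0∞) : ℝ≥0∞ :=
  (∫⁻ x, g x ^ p ∂μ) ^ (1 / p)

/-- Membership in the martingale Hardy space `H_p`: `‖f‖_{H_p} = ‖f*‖_{L_p} < ∞`. -/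
def MemHp (μ : Measure (Gm m)) (p : ℝ) (f : ℕ → Gm m → ℂ) : Prop :=
  eLp m μ p (mstar m f) ≠ ⊤

/-- The weak-`L_p` quasi-norm `sup_{t>0} t · μ(g > t)^{1/p}`. -/
def wLp (μ : Measure (Gm m)) (p : ℝ) (g : Gm m → ℝ≥0∞) : ℝ≥0∞ :=
  ⨆ t : ℝ≥0, (t : ℝ≥0∞) * μ {x | (t : ℝ≥0∞) < g x} ^ (1 / p)

end Vilenkin

namespace Vilenkin

variable {m : ℕ → ℕ}

theorem sum_range_mul_eq {R : Type*} [AddCommMonoid R] (A B : ℕ) (φ : ℕ → R) :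
    ∑ k ∈ range (A * B), φ k = ∑ b ∈ range B, ∑ i ∈ range A, φ (i + A * b) := by
  induction B with
  | zero => simp
  | succ B ih =>
    rw [Nat.mul_succ, sum_range_add, ih, sum_range_succ]
    simp only [add_comm]

theorem M_succ (k : ℕ) : M m (k + 1) = M m k * m k := mul_comm _ _

theorem M_pos (hm : ∀ k, 2 ≤ m k) (k : ℕ) : 0 < M m k := by
  induction k with
  | zero => exact Nat.one_pos
  | succ k ih => exact Nat.mul_pos (by linarith [hm k]) ih

theorem M_dvd {j k : ℕ} (h : j ≤ k) : M m j ∣ M m k := by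
  induction k, h using Nat.le_induction with
  | base => exact dvd_rfl
  | succ k _ ih => exact ih.trans (Dvd.intro_left _ rfl)

theorem M_le (hm : ∀ k, 2 ≤ m k) {j k : ℕ} (h : j ≤ k) : M m j ≤ M m k :=
  Nat.le_of_dvd (M_pos hm k) (M_dvd h)

theorem two_pow_mul_M_le (hm : ∀ k, 2 ≤ m k) (j i : ℕ) : 2 ^ i * M m j ≤ M m (j + i) := by
  induction i with
  | zero => simp
  | succ i ih =>
    rw [← add_assoc, M_succ, pow_succ]
    nlinarith [hm (j + i)]

theorem two_pow_le_M (hm : ∀ k, 2 ≤ m k) (k : ℕ) : 2 ^ k ≤ M m k := by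
  simpa [M] using two_pow_mul_M_le hm 0 k

theorem lt_M (hm : ∀ k, 2 ≤ m k) (k : ℕ) : k < M m k :=
  Nat.lt_two_pow_self.trans_le (two_pow_le_M hm k)

theorem digit_lt (hm : ∀ k, 2 ≤ m k) (n k : ℕ) : digit m n k < m k :=
  Nat.mod_lt _ (by linarith [hm k])

theorem digit_eq_zero (hm : ∀ k, 2 ≤ m k) {n j k : ℕ} (hn : n < M m j) (h : j ≤ k) :
    digit m n k = 0 := by
  rw [digit, Nat.div_eq_of_lt (hn.trans_le (M_le hm h)), Nat.zero_mod]

theorem digit_add_mul_of_lt (hm : ∀ k, 2 ≤ m k) (i a : ℕ) {j k : ℕ} (h : k < j) :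
    digit m (i + M m j * a) k = digit m i k := by
  obtain ⟨t, ht⟩ := M_dvd (m := m) (Nat.succ_le_of_lt h)
  rw [digit, digit, ht, M_succ, mul_assoc, mul_assoc, Nat.add_mul_div_left _ _ (M_pos hm k),
    Nat.add_mul_mod_self_left]

theorem digit_add_mul_of_le (hm : ∀ k, 2 ≤ m k) {i j k : ℕ} (a : ℕ) (hi : i < M m j)
    (h : j ≤ k) : digit m (i + M m j * a) k = digit m (M m j * a) k := by
  obtain ⟨t, ht⟩ := M_dvd (m := m) h
  have hp := M_pos hm j
  rw [digit, digit, ht, ← Nat.div_div_eq_div_mul, ← Nat.div_div_eq_div_mul,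
    Nat.add_mul_div_left _ _ hp, Nat.mul_div_cancel_left _ hp, Nat.div_eq_of_lt hi, zero_add]

theorem digit_add_mul (hm : ∀ k, 2 ≤ m k) {i j : ℕ} (a : ℕ) (hi : i < M m j) (k : ℕ) :
    digit m (i + M m j * a) k = digit m i k + digit m (M m j * a) k := by
  rcases lt_or_ge k j with h | h
  · have := digit_add_mul_of_lt hm 0 a h
    rw [zero_add] at this
    rw [digit_add_mul_of_lt hm i a h, this]
    simp [digit]
  · rw [digit_add_mul_of_le hm a hi h, digit_eq_zero hm hi h, zero_add]

/-- The number of the cylinder of length `n` that contains `x`. -/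
def idx (n : ℕ) (x : Gm m) : ℕ := ∑ k ∈ range n, (x k).val * M m k

/-- The point of `G_m` whose coordinates are the digits of `i`. -/
def pt (m : ℕ → ℕ) (i : ℕ) : Gm m := fun k => (digit m i k : ZMod (m k))

theorem idx_succ (n : ℕ) (x : Gm m) : idx (n + 1) x = idx n x + M m n * (x n).val := by
  rw [idx, sum_range_succ, mul_comm (M m n), idx]

theorem val_lt (hm : ∀ k, 2 ≤ m k) (x : Gm m) (k : ℕ) : (x k).val < m k :=
  have : NeZero (m k) := ⟨by linarith [hm k]⟩
  ZMod.val_lt _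

theorem idx_lt (hm : ∀ k, 2 ≤ m k) (n : ℕ) (x : Gm m) : idx n x < M m n := by
  induction n with
  | zero => simp [idx, M]
  | succ n ih =>
    rw [idx_succ, M_succ]
    have := val_lt hm x n
    nlinarith

theorem digit_idx (hm : ∀ k, 2 ≤ m k) {n k : ℕ} (x : Gm m) (h : k < n) :
    digit m (idx n x) k = (x k).val := by
  induction n with
  | zero => omega
  | succ n ih =>
    rw [idx_succ]
    rcases Nat.lt_succ_iff_lt_or_eq.1 h with h | rfl
    · rw [digit_add_mul_of_lt hm _ _ h, ih h]
    · rw [digit_add_mul_of_le hm _ (idx_lt hm k x) le_rfl, digit,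
        Nat.mul_div_cancel_left _ (M_pos hm k), Nat.mod_eq_of_lt (val_lt hm x k)]

theorem idx_eq_iff (hm : ∀ k, 2 ≤ m k) {n : ℕ} {x y : Gm m} :
    idx n x = idx n y ↔ ∀ k < n, x k = y k := by
  constructor
  · intro h k hk
    have : NeZero (m k) := ⟨by linarith [hm k]⟩
    apply ZMod.val_injective
    rw [← digit_idx hm x hk, h, digit_idx hm y hk]
  · intro h
    exact sum_congr rfl fun k hk => by rw [h k (mem_range.1 hk)]

theorem idx_pt (hm : ∀ k, 2 ≤ m k) (n i : ℕ) : idx n (pt m i) = i % M m n := by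
  induction n with
  | zero => simp [idx, M, Nat.mod_one]
  | succ n ih =>
    have : (pt m i n).val = i / M m n % m n := by
      rw [pt, ZMod.val_natCast, Nat.mod_eq_of_lt (digit_lt hm i n), digit]
    rw [idx_succ, M_succ, Nat.mod_mul, ih, this]

theorem cylAt_eq (hm : ∀ k, 2 ≤ m k) (n : ℕ) (x : Gm m) :
    cylAt m n x = {y | idx n y = idx n x} := by
  ext y
  exact (idx_eq_iff hm).symm

theorem idx_pt_of_lt (hm : ∀ k, 2 ≤ m k) {n i : ℕ} (hi : i < M m n) :
    idx n (pt m i) = i := by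
  rw [idx_pt hm, Nat.mod_eq_of_lt hi]

theorem sum_range_eq_blocks {R : Type*} [AddCommMonoid R] (φ : ℕ → R) (n J : ℕ) :
    ∑ k ∈ range n, φ k = ∑ k ∈ range (M m J * (n / M m J)), φ k +
      ∑ j ∈ range J, ∑ c ∈ range (digit m n j),
        ∑ i ∈ range (M m j), φ (i + M m j * (c + m j * (n / M m (j + 1)))) := by
  induction J with
  | zero => simp [M]
  | succ J ih =>
    have h : n / M m J = m J * (n / M m (J + 1)) + digit m n J := by
      rw [M_succ, ← Nat.div_div_eq_div_mul, digit, Nat.div_add_mod]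
    rw [ih, sum_range_succ _ J]
    nth_rw 1 [h]
    rw [mul_add, ← mul_assoc, ← M_succ, sum_range_add, add_assoc]
    congr 1
    rw [add_comm]
    congr 1
    rw [sum_range_mul_eq]
    refine sum_congr rfl fun c _ => sum_congr rfl fun i _ => ?_
    rw [M_succ]
    congr 1
    ring

theorem rad_eq (hm : ∀ k, 2 ≤ m k) (k : ℕ) (x : Gm m) :
    haveI : NeZero (m k) := ⟨by linarith [hm k]⟩
    rad m k x = ZMod.stdAddChar (x k) := by
  have : NeZero (m k) := ⟨by linarith [hm k]⟩
  rw [rad, ZMod.stdAddChar_apply, ZMod.toCircle_apply]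

theorem norm_vil (i : ℕ) (x : Gm m) : ‖vil m i x‖ = 1 := by
  rw [vil, norm_prod]
  refine prod_eq_one fun k _ => ?_
  have : rad m k x = Complex.exp ((2 * Real.pi * (x k).val / m k : ℝ) * Complex.I) := by
    rw [rad]; congr 1; push_cast; ring
  rw [norm_pow, this, Complex.norm_exp_ofReal_mul_I, one_pow]

theorem vil_eq_prod (hm : ∀ k, 2 ≤ m k) {n K : ℕ} (h : n < M m K) (x : Gm m) :
    vil m n x = ∏ k ∈ range K, rad m k x ^ digit m n k := by
  have key : ∀ L, n < M m L → ∏ k ∈ range L, rad m k x ^ digit m n k =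
      ∏ k ∈ range (max K (n + 1)) ∪ range L, rad m k x ^ digit m n k := by
    intro L hL
    refine prod_subset subset_union_right fun k _ hk => ?_
    rw [digit_eq_zero hm hL (by simpa using hk), pow_zero]
  have e1 := key K h
  have e2 := key (n + 1) ((lt_M hm n).trans_le (M_le hm n.le_succ))
  rw [union_eq_left.2 (range_subset_range.2 (le_max_left _ _))] at e1
  rw [union_eq_left.2 (range_subset_range.2 (le_max_right _ _))] at e2
  rw [e1, vil, e2]

theorem vil_congr (hm : ∀ k, 2 ≤ m k) {i n : ℕ} (hi : i < M m n) {x y : Gm m}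
    (h : idx n x = idx n y) : vil m i x = vil m i y := by
  rw [vil_eq_prod hm hi, vil_eq_prod hm hi]
  refine prod_congr rfl fun k hk => ?_
  rw [rad, rad, (idx_eq_iff hm).1 h k (mem_range.1 hk)]

theorem vil_add_mul (hm : ∀ k, 2 ≤ m k) {i j : ℕ} (a : ℕ) (hi : i < M m j) (x : Gm m) :
    vil m (i + M m j * a) x = vil m i x * vil m (M m j * a) x := by
  have h := lt_M hm (i + M m j * a)
  rw [vil_eq_prod hm h, vil_eq_prod hm ((Nat.le_add_right _ _).trans_lt h),
    vil_eq_prod hm ((Nat.le_add_left _ _).trans_lt h), ← prod_mul_distrib]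
  refine prod_congr rfl fun k _ => ?_
  rw [digit_add_mul hm a hi, pow_add]

theorem vil_mul_of_lt (hm : ∀ k, 2 ≤ m k) {j c : ℕ} (hc : c < m j) (x : Gm m) :
    vil m (M m j * c) x = rad m j x ^ c := by
  have hp := M_pos hm j
  rw [vil_eq_prod hm (K := j + 1) (by rw [M_succ]; exact Nat.mul_lt_mul_of_pos_left hc hp),
    prod_range_succ, digit, Nat.mul_div_cancel_left _ hp, Nat.mod_eq_of_lt hc]
  rw [prod_eq_one, one_mul]
  intro k hk
  have := digit_add_mul_of_lt hm 0 c (mem_range.1 hk)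
  rw [zero_add] at this
  rw [this]
  simp [digit]

theorem sum_rad (hm : ∀ k, 2 ≤ m k) (k : ℕ) (x t : Gm m) :
    ∑ c ∈ range (m k), rad m k x ^ c * (starRingEnd ℂ) (rad m k t ^ c) =
      if x k = t k then (m k : ℂ) else 0 := by
  have : NeZero (m k) := ⟨by linarith [hm k]⟩
  have hw : ∀ c : ℕ, rad m k x ^ c * (starRingEnd ℂ) (rad m k t ^ c) =
      (ZMod.stdAddChar (x k - t k)) ^ c := by
    intro c
    rw [map_pow, ← mul_pow, rad_eq hm, rad_eq hm, sub_eq_add_neg (x k) (t k), AddChar.map_add_eq_mul,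
      AddChar.map_neg_eq_conj]
  simp_rw [hw]
  split_ifs with h
  · simp [h]
  · have h1 : (ZMod.stdAddChar (x k - t k) : ℂ) ≠ 1 := by
      intro h1
      apply h
      rw [← sub_eq_zero]
      apply ZMod.injective_stdAddChar
      rw [h1, AddChar.map_zero_eq_one]
    have h2 : (ZMod.stdAddChar (x k - t k) : ℂ) ^ m k = 1 := by
      rw [← AddChar.map_nsmul_eq_pow]
      simp
    have := mul_geom_sum (ZMod.stdAddChar (x k - t k) : ℂ) (m k)
    rw [h2, sub_self] at this
    exact (mul_eq_zero.1 this).resolve_left (sub_ne_zero.2 h1)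

theorem sum_vil_mul_conj (hm : ∀ k, 2 ≤ m k) (n : ℕ) (x t : Gm m) :
    ∑ i ∈ range (M m n), vil m i x * (starRingEnd ℂ) (vil m i t) =
      if idx n x = idx n t then (M m n : ℂ) else 0 := by
  induction n with
  | zero => simp [M, idx, vil, digit]
  | succ n ih =>
    rw [M_succ, sum_range_mul_eq]
    have : ∀ c ∈ range (m n), ∑ i ∈ range (M m n), vil m (i + M m n * c) x *
        (starRingEnd ℂ) (vil m (i + M m n * c) t) = (if idx n x = idx n t then (M m n : ℂ) else 0) *
        (rad m n x ^ c * (starRingEnd ℂ) (rad m n t ^ c)) := by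
      intro c hc
      rw [← ih, sum_mul]
      refine sum_congr rfl fun i hi => ?_
      rw [vil_add_mul hm c (mem_range.1 hi), vil_add_mul hm c (mem_range.1 hi),
        vil_mul_of_lt hm (mem_range.1 hc), vil_mul_of_lt hm (mem_range.1 hc), map_mul]
      ring
    rw [sum_congr rfl this, ← mul_sum, sum_rad hm]
    have h : idx (n + 1) x = idx (n + 1) t ↔ idx n x = idx n t ∧ x n = t n := by
      simp only [idx_eq_iff hm, Nat.lt_succ_iff_lt_or_eq]
      constructor
      · exact fun h => ⟨fun k hk => h k (Or.inl hk), h n (Or.inr rfl)⟩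
      · rintro ⟨h, h'⟩ k (hk | rfl)
        exacts [h k hk, h']
    by_cases h1 : idx n x = idx n t <;> by_cases h2 : x n = t n <;> simp [h, h1, h2]

theorem isProbabilityMeasure_of_isHaar {μ : Measure (Gm m)} (hμ : IsHaar m μ) :
    IsProbabilityMeasure μ := by
  constructor
  have h := hμ 0 0
  have hu : cylAt m 0 (0 : Gm m) = Set.univ := by
    ext y
    simp [cylAt]
  simpa [hu, M] using h

theorem measurableSet_cylAt (n : ℕ) (x : Gm m) : MeasurableSet (cylAt m n x) := by
  have : cylAt m n x = ⋂ k, ⋂ (_ : k < n), (fun y : Gm m => y k) ⁻¹' {x k} := by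
    ext y
    simp [cylAt]
  rw [this]
  exact MeasurableSet.iInter fun k => MeasurableSet.iInter fun _ =>
    measurable_pi_apply k (MeasurableSpace.measurableSet_top)

theorem mem_cylAt_pt (hm : ∀ k, 2 ≤ m k) {n i : ℕ} (hi : i < M m n) (x : Gm m) :
    x ∈ cylAt m n (pt m i) ↔ idx n x = i := by
  rw [cylAt_eq hm, Set.mem_ofPred_eq, idx_pt_of_lt hm hi]

theorem iUnion_cylAt (hm : ∀ k, 2 ≤ m k) (n : ℕ) :
    ⋃ i ∈ range (M m n), cylAt m n (pt m i) = Set.univ := by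
  refine Set.eq_univ_of_forall fun x => ?_
  have h := mem_range.2 (idx_lt hm n x)
  exact Set.mem_biUnion (t := fun i => cylAt m n (pt m i)) h
    ((mem_cylAt_pt hm (mem_range.1 h) x).2 rfl)

theorem pairwiseDisjoint_cylAt (hm : ∀ k, 2 ≤ m k) (n : ℕ) :
    (range (M m n) : Set ℕ).PairwiseDisjoint fun i => cylAt m n (pt m i) := by
  intro i hi j hj hij
  refine Set.disjoint_left.2 fun x hx hx' => hij ?_
  rw [mem_cylAt_pt hm (by simpa using hi)] at hx
  rw [mem_cylAt_pt hm (by simpa using hj)] at hx'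
  rw [← hx, hx']

theorem lintegral_eq_sum_cylAt (hm : ∀ k, 2 ≤ m k) (μ : Measure (Gm m)) (n : ℕ)
    (g : Gm m → ℝ≥0∞) :
    ∫⁻ x, g x ∂μ = ∑ i ∈ range (M m n), ∫⁻ x in cylAt m n (pt m i), g x ∂μ := by
  rw [← lintegral_biUnion_finset (pairwiseDisjoint_cylAt hm n)
    (fun i _ => measurableSet_cylAt n _), iUnion_cylAt hm, setLIntegral_univ]

theorem lintegral_eq_sum_of_dep (hm : ∀ k, 2 ≤ m k) {μ : Measure (Gm m)} (hμ : IsHaar m μ)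
    {n : ℕ} {g : Gm m → ℝ≥0∞} (hg : ∀ x y, idx n x = idx n y → g x = g y) :
    ∫⁻ x, g x ∂μ = (M m n : ℝ≥0∞)⁻¹ * ∑ i ∈ range (M m n), g (pt m i) := by
  rw [lintegral_eq_sum_cylAt hm μ n, mul_sum]
  refine sum_congr rfl fun i hi => ?_
  rw [setLIntegral_congr_fun (g := fun _ => g (pt m i)) (measurableSet_cylAt n _) fun x hx => ?_,
    setLIntegral_const, hμ, mul_comm]
  exact hg _ _ ((cylAt_eq hm n _).subset hx)

theorem integrable_of_dep (hm : ∀ k, 2 ≤ m k) {μ : Measure (Gm m)} (hμ : IsHaar m μ)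
    {n : ℕ} {g : Gm m → ℂ} (hg : ∀ x y, idx n x = idx n y → g x = g y) : Integrable g μ := by
  have := isProbabilityMeasure_of_isHaar hμ
  rw [← integrableOn_univ, ← iUnion_cylAt hm n, integrableOn_finset_iUnion]
  intro i _
  refine (integrableOn_const (C := g (pt m i)) (measure_ne_top μ _)).congr_fun (fun x hx => ?_)
    (measurableSet_cylAt n _)
  exact (hg _ _ ((cylAt_eq hm n _).subset hx)).symm

theorem integral_martingale_mul (hm : ∀ k, 2 ≤ m k) {μ : Measure (Gm m)} (hμ : IsHaar m μ)
    {f : ℕ → Gm m → ℂ} (hf : IsMartingale m μ f) {n N : ℕ} (hn : n ≤ N) {g : Gm m → ℂ}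
    (hg : ∀ x y, idx n x = idx n y → g x = g y) :
    ∫ x, f N x * g x ∂μ =
      (M m n : ℂ)⁻¹ * ∑ i ∈ range (M m n), f n (pt m i) * g (pt m i) := by
  have hint : Integrable (fun x => f N x * g x) μ := by
    refine integrable_of_dep hm hμ (n := N) fun x y h => ?_
    have h' := (idx_eq_iff hm).1 h
    rw [hf.adapted N x y h', hg x y ((idx_eq_iff hm).2 fun k hk => h' k (hk.trans_le hn))]
  rw [← setIntegral_univ, ← iUnion_cylAt hm n, integral_biUnion_finset _
    (fun i _ => measurableSet_cylAt n _) (pairwiseDisjoint_cylAt hm n)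
    (fun i _ => hint.integrableOn), mul_sum]
  refine sum_congr rfl fun i _ => ?_
  rw [setIntegral_congr_fun (g := fun x => f N x * g (pt m i)) (measurableSet_cylAt n _)
    fun x hx => ?_, integral_mul_const, hf.mart n N hn (pt m i)]
  · have : (M m n : ℂ) ≠ 0 := Nat.cast_ne_zero.2 (M_pos hm n).ne'
    field_simp
  · simp only
    rw [hg _ _ ((cylAt_eq hm n _).subset hx)]

theorem coeff_eq (hm : ∀ k, 2 ≤ m k) {μ : Measure (Gm m)} (hμ : IsHaar m μ)
    {f : ℕ → Gm m → ℂ} (hf : IsMartingale m μ f) {n i : ℕ} (hi : i < M m n) :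
    coeff m μ f i = (M m n : ℂ)⁻¹ * ∑ l ∈ range (M m n),
      f n (pt m l) * (starRingEnd ℂ) (vil m i (pt m l)) := by
  have hd : ∀ K, i < M m K → ∀ x y : Gm m, idx K x = idx K y →
      (starRingEnd ℂ) (vil m i x) = (starRingEnd ℂ) (vil m i y) := by
    intro K hK x y h
    rw [vil_congr hm hK h]
  have hi' : i < M m (i + 1) := (lt_M hm i).trans_le (M_le hm i.le_succ)
  rw [coeff]
  rcases le_total n (i + 1) with h | h
  · exact integral_martingale_mul hm hμ hf h (hd n hi)
  · rw [integral_martingale_mul hm hμ hf le_rfl (hd (i + 1) hi'),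
      ← integral_martingale_mul hm hμ hf h (hd (i + 1) hi'),
      integral_martingale_mul hm hμ hf le_rfl (hd n hi)]

theorem rpow_sum_le_sum_rpow {ι : Type*} (s : Finset ι) (a : ι → ℝ≥0∞) {t : ℝ} (h0 : 0 < t)
    (h1 : t ≤ 1) : (∑ i ∈ s, a i) ^ t ≤ ∑ i ∈ s, a i ^ t :=
  Finset.le_sum_of_subadditive (fun x : ℝ≥0∞ => x ^ t) (ENNReal.zero_rpow_of_pos h0).le
    (fun x y => ENNReal.rpow_add_le_add_rpow x y h0.le h1) s a

theorem rpow_tsum_le_tsum_rpow {ι : Type*} (a : ι → ℝ≥0∞) {t : ℝ} (h0 : 0 < t)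
    (h1 : t ≤ 1) : (∑' i, a i) ^ t ≤ ∑' i, a i ^ t := by
  have h : Filter.Tendsto (fun s : Finset ι => (∑ i ∈ s, a i) ^ t) Filter.atTop
      (nhds ((∑' i, a i) ^ t)) :=
    (ENNReal.continuous_rpow_const.tendsto _).comp ENNReal.summable.hasSum
  exact le_of_tendsto' h fun s => (rpow_sum_le_sum_rpow s a h0 h1).trans (ENNReal.sum_le_tsum s)

theorem tsum_dyadic_lt_le (y : ℝ≥0∞) :
    ∑' k : ℤ, (if (2 : ℝ≥0∞) ^ k < y then (2 : ℝ≥0∞) ^ k else 0) ≤ 2 * y := by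
  rcases eq_or_ne y 0 with rfl | h0
  · simp
  rcases eq_or_ne y ⊤ with rfl | ht
  · simp
  obtain ⟨K, hK, hK'⟩ := ENNReal.exists_mem_Ioc_zpow h0 ht (y := 2) (by norm_num) (by norm_num)
  have hinj : Function.Injective fun i : ℕ => K - (i : ℤ) := fun i j h => by simpa using h
  rw [← hinj.tsum_eq]
  · calc ∑' i : ℕ, (if (2 : ℝ≥0∞) ^ (K - (i : ℤ)) < y then (2 : ℝ≥0∞) ^ (K - (i : ℤ)) else 0)
        ≤ ∑' i : ℕ, (2 : ℝ≥0∞) ^ K * (2⁻¹) ^ i := by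
          refine ENNReal.tsum_le_tsum fun i => ?_
          rw [sub_eq_add_neg, ENNReal.zpow_add (by norm_num) (by norm_num), ENNReal.zpow_neg,
            zpow_natCast, ENNReal.inv_pow]
          split_ifs <;> simp
      _ = 2 * 2 ^ K := by
          rw [ENNReal.tsum_mul_left, ENNReal.tsum_geometric, ENNReal.one_sub_inv_two, inv_inv,
            mul_comm]
      _ ≤ 2 * y := by gcongr
  · intro k hk
    have hk' : (2 : ℝ≥0∞) ^ k < y := by
      by_contra h
      simp [h] at hk
    have : k ≤ K := by
      by_contra! h
      have : (2 : ℝ≥0∞) ^ (K + 1) ≤ 2 ^ k := ENNReal.zpow_le_of_le (by norm_num) h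
      exact absurd (hk'.trans_le hK') this.not_gt
    exact ⟨(K - k).toNat, by simp [this]⟩

theorem rpow_le_tsum_dyadic {q : ℝ} (hq : 0 < q) {y : ℝ≥0∞} (hy : y ≠ ⊤) :
    y ^ q ≤ ∑' k : ℤ, (2 * (2 : ℝ≥0∞) ^ k) ^ q * (if (2 : ℝ≥0∞) ^ k < y then 1 else 0) := by
  rcases eq_or_ne y 0 with rfl | h0
  · simp [ENNReal.zero_rpow_of_pos hq]
  obtain ⟨K, hK, hK'⟩ := ENNReal.exists_mem_Ioc_zpow h0 hy (y := 2) (by norm_num) (by norm_num)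
  refine le_trans ?_ (ENNReal.le_tsum K)
  rw [if_pos hK, mul_one]
  refine ENNReal.rpow_le_rpow (hK'.trans_eq ?_) hq.le
  rw [ENNReal.zpow_add (by norm_num) (by norm_num), zpow_one, mul_comm]

theorem tsum_inv_M_mul_rpow_le (hm : ∀ k, 2 ≤ m k) {s : ℝ} (h0 : 0 < s) (h1 : s < 1)
    {τ : ℝ≥0∞} (hτ : τ ≠ ⊤) {c : ℕ → ℕ} (hc : ∀ N, (c N : ℝ≥0∞) ≤ M m N * τ) :
    ∑' N, (M m N : ℝ≥0∞)⁻¹ * (c N : ℝ≥0∞) ^ s ≤ (1 - (2 : ℝ≥0∞) ^ (s - 1))⁻¹ * τ := by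
  classical
  by_cases hz : ∃ N, c N ≠ 0
  swap
  · push Not at hz
    simp [hz, ENNReal.zero_rpow_of_pos h0]
  set N₀ := Nat.find hz with hN₀
  have hinj : Function.Injective fun i : ℕ => N₀ + i := add_right_injective N₀
  rw [← hinj.tsum_eq, ← ENNReal.tsum_geometric, ← ENNReal.tsum_mul_right]
  · refine ENNReal.tsum_le_tsum fun i => ?_
    have hM0 : (M m (N₀ + i) : ℝ≥0∞) ≠ 0 := by exact_mod_cast (M_pos hm _).ne'
    have hMt : (M m (N₀ + i) : ℝ≥0∞) ≠ ⊤ := ENNReal.natCast_ne_top _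
    set x := (M m (N₀ + i) : ℝ≥0∞) * τ with hx
    have hone : 1 ≤ (M m N₀ : ℝ≥0∞) * τ :=
      le_trans (by exact_mod_cast Nat.one_le_iff_ne_zero.2 (Nat.find_spec hz)) (hc N₀)
    have hx2 : (2 : ℝ≥0∞) ^ i ≤ x := by
      calc (2 : ℝ≥0∞) ^ i ≤ 2 ^ i * (M m N₀ * τ) := le_mul_of_one_le_right' hone
        _ = ((2 ^ i * M m N₀ : ℕ) : ℝ≥0∞) * τ := by push_cast; ring
        _ ≤ x := by
          rw [hx]
          gcongr
          exact two_pow_mul_M_le hm N₀ i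
    have hx0 : x ≠ 0 := (lt_of_lt_of_le (by positivity) hx2).ne'
    have hxt : x ≠ ⊤ := ENNReal.mul_ne_top hMt hτ
    calc (M m (N₀ + i) : ℝ≥0∞)⁻¹ * (c (N₀ + i) : ℝ≥0∞) ^ s
        ≤ (M m (N₀ + i) : ℝ≥0∞)⁻¹ * x ^ s := by
          gcongr
          exact hc _
      _ = (M m (N₀ + i) : ℝ≥0∞)⁻¹ * (x ^ (s - 1) * x) := by
          nth_rw 3 [← ENNReal.rpow_one x]
          rw [← ENNReal.rpow_add _ _ hx0 hxt, sub_add_cancel]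
      _ = x ^ (s - 1) * τ * ((M m (N₀ + i) : ℝ≥0∞)⁻¹ * M m (N₀ + i)) := by
          nth_rw 2 [hx]
          ring
      _ = x ^ (s - 1) * τ := by rw [ENNReal.inv_mul_cancel hM0 hMt, mul_one]
      _ ≤ ((2 : ℝ≥0∞) ^ (s - 1)) ^ i * τ := by
          gcongr
          rw [← ENNReal.rpow_natCast, ← ENNReal.rpow_mul, mul_comm (s - 1), ENNReal.rpow_mul,
            ENNReal.rpow_natCast]
          rw [← neg_sub, ENNReal.rpow_neg, ENNReal.rpow_neg, ENNReal.inv_le_inv]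
          exact ENNReal.rpow_le_rpow hx2 (by linarith)
  · intro N hN
    have : N₀ ≤ N := Nat.find_min' hz fun h => by
      simp [h, ENNReal.zero_rpow_of_pos h0] at hN
    exact ⟨N - N₀, by simp [this]⟩

theorem tsum_level_le (hm : ∀ k, 2 ≤ m k) {μ : Measure (Gm m)} (hμ : IsHaar m μ) {q : ℝ}
    (hq : 1 < q) {U : Gm m → ℝ≥0∞} (hU : AEMeasurable U μ) {u : ℕ → ℕ → ℝ≥0∞}
    (hut : ∀ N i, u N i ≠ ⊤)
    (hu : ∀ N, ∀ i < M m N, ∀ x ∈ cylAt m N (pt m i), u N i ≤ U x) :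
    ∑' N, (M m N : ℝ≥0∞)⁻¹ * (∑ i ∈ range (M m N), u N i ^ q) ^ q⁻¹ ≤
      4 * (1 - (2 : ℝ≥0∞) ^ (q⁻¹ - 1))⁻¹ * ∫⁻ x, U x ∂μ := by
  classical
  have := isProbabilityMeasure_of_isHaar hμ
  have hq0 : 0 < q := by linarith
  have hs0 : 0 < q⁻¹ := by positivity
  have hs1 : q⁻¹ < 1 := inv_lt_one_of_one_lt₀ hq
  set τ : ℤ → ℝ≥0∞ := fun k => ∫⁻ x, (if (2 : ℝ≥0∞) ^ k < U x then 1 else 0) ∂μ with hτ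
  set c : ℤ → ℕ → ℕ := fun k N => #{i ∈ range (M m N) | (2 : ℝ≥0∞) ^ k < u N i} with hc
  have hτt : ∀ k, τ k ≠ ⊤ := by
    intro k
    refine ne_top_of_le_ne_top ENNReal.one_ne_top ?_
    calc τ k ≤ ∫⁻ _, 1 ∂μ := lintegral_mono fun x => by split_ifs <;> simp
      _ = 1 := by simp
  have hcτ : ∀ k N, (c k N : ℝ≥0∞) ≤ M m N * τ k := by
    intro k N
    have hM0 : (M m N : ℝ≥0∞) ≠ 0 := by exact_mod_cast (M_pos hm _).ne'
    have hMt : (M m N : ℝ≥0∞) ≠ ⊤ := ENNReal.natCast_ne_top _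
    rw [hτ]
    simp only
    rw [lintegral_eq_sum_cylAt hm μ N, mul_sum, hc]
    simp only
    rw [card_filter, Nat.cast_sum]
    refine sum_le_sum fun i hi => ?_
    split_ifs with h
    · calc ((1 : ℕ) : ℝ≥0∞) = M m N * ∫⁻ _ in cylAt m N (pt m i), 1 ∂μ := by
            rw [setLIntegral_one, hμ, ENNReal.mul_inv_cancel hM0 hMt, Nat.cast_one]
        _ ≤ _ := by
            gcongr 1
            refine setLIntegral_mono_ae' (measurableSet_cylAt _ _) (ae_of_all _ fun x hx => ?_)
            rw [if_pos (h.trans_le (hu N i (mem_range.1 hi) x hx))]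
    · simp
  have hterm : ∀ N, (∑ i ∈ range (M m N), u N i ^ q) ^ q⁻¹ ≤
      ∑' k : ℤ, 2 * (2 : ℝ≥0∞) ^ k * (c k N : ℝ≥0∞) ^ q⁻¹ := by
    intro N
    calc (∑ i ∈ range (M m N), u N i ^ q) ^ q⁻¹
        ≤ (∑ i ∈ range (M m N), ∑' k : ℤ, (2 * (2 : ℝ≥0∞) ^ k) ^ q *
            (if (2 : ℝ≥0∞) ^ k < u N i then 1 else 0)) ^ q⁻¹ := by
          gcongr with i
          exact rpow_le_tsum_dyadic hq0 (hut N i)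
      _ = (∑' k : ℤ, (2 * (2 : ℝ≥0∞) ^ k) ^ q * (c k N : ℝ≥0∞)) ^ q⁻¹ := by
          rw [← Summable.tsum_finsetSum fun _ _ => ENNReal.summable]
          simp_rw [← mul_sum]
          simp [hc, sum_boole]
      _ ≤ ∑' k : ℤ, ((2 * (2 : ℝ≥0∞) ^ k) ^ q * (c k N : ℝ≥0∞)) ^ q⁻¹ :=
          rpow_tsum_le_tsum_rpow _ hs0 hs1.le
      _ = _ := by
          refine tsum_congr fun k => ?_
          rw [ENNReal.mul_rpow_of_nonneg _ _ hs0.le, ENNReal.rpow_rpow_inv hq0.ne']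
  calc ∑' N, (M m N : ℝ≥0∞)⁻¹ * (∑ i ∈ range (M m N), u N i ^ q) ^ q⁻¹
      ≤ ∑' N, ∑' k : ℤ, 2 * (2 : ℝ≥0∞) ^ k *
          ((M m N : ℝ≥0∞)⁻¹ * (c k N : ℝ≥0∞) ^ q⁻¹) := by
        refine ENNReal.tsum_le_tsum fun N => ?_
        calc _ ≤ (M m N : ℝ≥0∞)⁻¹ * ∑' k : ℤ, 2 * (2 : ℝ≥0∞) ^ k * (c k N : ℝ≥0∞) ^ q⁻¹ := by
              gcongr
              exact hterm N
          _ = _ := by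
              rw [← ENNReal.tsum_mul_left]
              exact tsum_congr fun k => by ring
    _ = ∑' k : ℤ, 2 * (2 : ℝ≥0∞) ^ k *
          ∑' N, (M m N : ℝ≥0∞)⁻¹ * (c k N : ℝ≥0∞) ^ q⁻¹ := by
        rw [ENNReal.tsum_comm]
        simp_rw [ENNReal.tsum_mul_left]
    _ ≤ ∑' k : ℤ, 2 * (2 : ℝ≥0∞) ^ k * ((1 - (2 : ℝ≥0∞) ^ (q⁻¹ - 1))⁻¹ * τ k) := by
        gcongr with k
        exact tsum_inv_M_mul_rpow_le hm hs0 hs1 (hτt k) (hcτ k)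
    _ = 2 * (1 - (2 : ℝ≥0∞) ^ (q⁻¹ - 1))⁻¹ * ∑' k : ℤ, 2 ^ k * τ k := by
        rw [← ENNReal.tsum_mul_left]
        exact tsum_congr fun k => by ring
    _ = 2 * (1 - (2 : ℝ≥0∞) ^ (q⁻¹ - 1))⁻¹ *
          ∫⁻ x, ∑' k : ℤ, (if (2 : ℝ≥0∞) ^ k < U x then (2 : ℝ≥0∞) ^ k else 0) ∂μ := by
        have hmeas : ∀ (k : ℤ) (a : ℝ≥0∞),
            AEMeasurable (fun x => if (2 : ℝ≥0∞) ^ k < U x then a else 0) μ := fun k a =>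
          ((measurable_const (a := a)).ite (measurableSet_Ioi (a := (2 : ℝ≥0∞) ^ k))
            (measurable_const (a := (0 : ℝ≥0∞)))).comp_aemeasurable hU
        rw [lintegral_tsum fun k => hmeas k _]
        congr 1
        refine tsum_congr fun k => ?_
        rw [hτ, ← lintegral_const_mul'' _ (hmeas k 1)]
        simp
    _ ≤ 2 * (1 - (2 : ℝ≥0∞) ^ (q⁻¹ - 1))⁻¹ * ∫⁻ x, 2 * U x ∂μ := by
        gcongr with x
        exact tsum_dyadic_lt_le _
    _ = _ := by
        rw [lintegral_const_mul'' _ hU]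
        ring

theorem sum_vil_mul_conj_of_idx_eq (hm : ∀ k, 2 ≤ m k) {j A n : ℕ} (hA : M m n = M m j * A)
    {x t : Gm m} (h : idx j x = idx j t) :
    ∑ a ∈ range A, vil m (M m j * a) x * (starRingEnd ℂ) (vil m (M m j * a) t) =
      if idx n x = idx n t then (A : ℂ) else 0 := by
  have hs := sum_vil_mul_conj hm n x t
  rw [hA, sum_range_mul_eq] at hs
  have hin : ∀ a ∈ range A, ∑ i ∈ range (M m j), vil m (i + M m j * a) x *
      (starRingEnd ℂ) (vil m (i + M m j * a) t) =
      M m j * (vil m (M m j * a) x * (starRingEnd ℂ) (vil m (M m j * a) t)) := by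
    intro a _
    rw [← nsmul_eq_mul, ← card_range (M m j), ← sum_const, card_range]
    refine sum_congr rfl fun i hi => ?_
    have hi := mem_range.1 hi
    have h1 : vil m i t * (starRingEnd ℂ) (vil m i t) = 1 := by
      rw [Complex.mul_conj', norm_vil]
      simp
    rw [vil_add_mul hm a hi, vil_add_mul hm a hi, vil_congr hm hi h, map_mul]
    linear_combination vil m (M m j * a) x * (starRingEnd ℂ) (vil m (M m j * a) t) * h1
  rw [sum_congr rfl hin, ← mul_sum] at hs
  have hM : (M m j : ℂ) ≠ 0 := Nat.cast_ne_zero.2 (M_pos hm j).ne'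
  apply mul_left_cancel₀ hM
  rw [hs]
  split_ifs <;> simp

theorem sum_norm_sq_coeff (hm : ∀ k, 2 ≤ m k) {j A n : ℕ} (hA : M m n = M m j * A)
    (r : ℕ) (g : ℕ → ℂ) :
    ∑ a ∈ range A, ‖∑ l ∈ range (M m n) with l % M m j = r,
        g l * (starRingEnd ℂ) (vil m (M m j * a) (pt m l))‖ ^ 2 =
      A * ∑ l ∈ range (M m n) with l % M m j = r, ‖g l‖ ^ 2 := by
  set s := (range (M m n)).filter fun l => l % M m j = r with hs
  have key : ∀ l ∈ s, ∀ l' ∈ s, ∑ a ∈ range A, vil m (M m j * a) (pt m l') *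
      (starRingEnd ℂ) (vil m (M m j * a) (pt m l)) = if l' = l then (A : ℂ) else 0 := by
    intro l hl l' hl'
    rw [hs, mem_filter, mem_range] at hl hl'
    rw [sum_vil_mul_conj_of_idx_eq hm hA (by rw [idx_pt hm, idx_pt hm, hl.2, hl'.2]),
      idx_pt_of_lt hm hl.1, idx_pt_of_lt hm hl'.1]
  apply Complex.ofReal_injective
  push_cast
  calc ∑ a ∈ range A, ((‖∑ l ∈ s, g l * (starRingEnd ℂ) (vil m (M m j * a) (pt m l))‖ : ℝ) : ℂ) ^ 2
      = ∑ a ∈ range A, ∑ l ∈ s, ∑ l' ∈ s, g l * (starRingEnd ℂ) (g l') *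
          (vil m (M m j * a) (pt m l') * (starRingEnd ℂ) (vil m (M m j * a) (pt m l))) := by
        refine sum_congr rfl fun a _ => ?_
        rw [← Complex.mul_conj', map_sum, sum_mul_sum]
        refine sum_congr rfl fun l _ => sum_congr rfl fun l' _ => ?_
        rw [map_mul, Complex.conj_conj]
        ring
    _ = ∑ l ∈ s, ∑ l' ∈ s, g l * (starRingEnd ℂ) (g l') * ∑ a ∈ range A,
          (vil m (M m j * a) (pt m l') * (starRingEnd ℂ) (vil m (M m j * a) (pt m l))) := by
        rw [sum_comm]
        refine sum_congr rfl fun l _ => ?_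
        rw [sum_comm]
        exact sum_congr rfl fun l' _ => (mul_sum _ _ _).symm
    _ = ∑ l ∈ s, A * (‖g l‖ : ℂ) ^ 2 := by
        refine sum_congr rfl fun l hl => ?_
        rw [sum_congr rfl fun l' hl' => by rw [key l hl l' hl']]
        simp only [mul_ite, mul_zero]
        rw [sum_ite_eq' s l, if_pos hl, Complex.mul_conj', mul_comm]
    _ = _ := by rw [mul_sum]

theorem norm_sum_block (hm : ∀ k, 2 ≤ m k) {μ : Measure (Gm m)} (hμ : IsHaar m μ)
    {f : ℕ → Gm m → ℂ} (hf : IsMartingale m μ f) {j A n a : ℕ} (hA : M m n = M m j * A)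
    (ha : a < A) (x : Gm m) :
    ‖∑ i ∈ range (M m j), coeff m μ f (i + M m j * a) * vil m (i + M m j * a) x‖ =
      (A : ℝ)⁻¹ * ‖∑ l ∈ range (M m n) with l % M m j = idx j x,
        f n (pt m l) * (starRingEnd ℂ) (vil m (M m j * a) (pt m l))‖ := by
  have hM : (M m j : ℂ) ≠ 0 := Nat.cast_ne_zero.2 (M_pos hm j).ne'
  have hlt : ∀ i ∈ range (M m j), i + M m j * a < M m n := by
    intro i hi
    have := mem_range.1 hi
    rw [hA]
    nlinarith
  have key : ∑ i ∈ range (M m j), coeff m μ f (i + M m j * a) * vil m (i + M m j * a) x =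
      (A : ℂ)⁻¹ * (vil m (M m j * a) x * ∑ l ∈ range (M m n) with l % M m j = idx j x,
        f n (pt m l) * (starRingEnd ℂ) (vil m (M m j * a) (pt m l))) := by
    calc _ = ∑ i ∈ range (M m j), ∑ l ∈ range (M m n), (M m n : ℂ)⁻¹ * vil m (M m j * a) x *
          (f n (pt m l) * (starRingEnd ℂ) (vil m (M m j * a) (pt m l))) *
          (vil m i x * (starRingEnd ℂ) (vil m i (pt m l))) := by
          refine sum_congr rfl fun i hi => ?_
          rw [coeff_eq hm hμ hf (hlt i hi), mul_sum, sum_mul]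
          refine sum_congr rfl fun l _ => ?_
          rw [vil_add_mul hm a (mem_range.1 hi), vil_add_mul hm a (mem_range.1 hi), map_mul]
          ring
      _ = ∑ l ∈ range (M m n), if l % M m j = idx j x then (M m n : ℂ)⁻¹ * vil m (M m j * a) x *
          (f n (pt m l) * (starRingEnd ℂ) (vil m (M m j * a) (pt m l))) * M m j else 0 := by
          rw [sum_comm]
          refine sum_congr rfl fun l _ => ?_
          rw [← mul_sum, sum_vil_mul_conj hm, idx_pt hm]
          simp only [eq_comm (a := idx j x), mul_ite, mul_zero]
      _ = _ := by
          rw [← sum_filter, ← sum_mul, ← mul_sum, hA]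
          push_cast
          field_simp
  rw [key, norm_mul, norm_mul, norm_vil, one_mul, norm_inv, Complex.norm_natCast]

theorem S_eq_sum_blocks (μ : Measure (Gm m)) (f : ℕ → Gm m → ℂ) {n J : ℕ}
    (hn : n < M m J) (x : Gm m) :
    S m μ f n x = ∑ j ∈ range J, ∑ c ∈ range (digit m n j), ∑ i ∈ range (M m j),
      coeff m μ f (i + M m j * (c + m j * (n / M m (j + 1)))) *
        vil m (i + M m j * (c + m j * (n / M m (j + 1)))) x := by
  rw [S, sum_range_eq_blocks _ n J, Nat.div_eq_of_lt hn, mul_zero, range_zero, sum_empty, zero_add]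

theorem sum_rpow_le_card_mul (s : Finset ℕ) {p : ℝ} (hp0 : 0 < p) (hp2 : p ≤ 2) (z : ℕ → ℝ≥0∞) :
    ∑ i ∈ s, z i ^ p ≤ (#s : ℝ≥0∞) ^ (1 - p / 2) * (∑ i ∈ s, z i ^ 2) ^ (p / 2) := by
  have h := ENNReal.rpow_sum_le_const_mul_sum_rpow s (fun i => z i ^ p) (p := 2 / p)
    ((one_le_div hp0).2 hp2)
  have h2 : ∀ i, (z i ^ p) ^ (2 / p) = z i ^ 2 := by
    intro i
    rw [← ENNReal.rpow_mul, mul_div_cancel₀ _ hp0.ne', ENNReal.rpow_two]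
  simp only [h2] at h
  have h3 := ENNReal.rpow_le_rpow h (by positivity : 0 ≤ p / 2)
  rw [← ENNReal.rpow_mul, ENNReal.mul_rpow_of_nonneg _ _ (by positivity : 0 ≤ p / 2),
    ← ENNReal.rpow_mul] at h3
  rw [show 2 / p * (p / 2) = 1 by field_simp, ENNReal.rpow_one,
    show (2 / p - 1) * (p / 2) = 1 - p / 2 by field_simp] at h3
  exact h3

theorem sum_enorm_sq_coeff (hm : ∀ k, 2 ≤ m k) {j A n : ℕ} (hA : M m n = M m j * A)
    (r : ℕ) (g : ℕ → ℂ) :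
    ∑ a ∈ range A, ‖∑ l ∈ range (M m n) with l % M m j = r,
        g l * (starRingEnd ℂ) (vil m (M m j * a) (pt m l))‖ₑ ^ 2 =
      A * ∑ l ∈ range (M m n) with l % M m j = r, ‖g l‖ₑ ^ 2 := by
  have h := congrArg ENNReal.ofReal (sum_norm_sq_coeff hm hA r g)
  rw [ENNReal.ofReal_mul (Nat.cast_nonneg _), ENNReal.ofReal_natCast,
    ENNReal.ofReal_sum_of_nonneg fun _ _ => by positivity,
    ENNReal.ofReal_sum_of_nonneg fun _ _ => by positivity] at h
  simpa only [ENNReal.ofReal_pow (norm_nonneg _), ofReal_norm] using h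

theorem enorm_sum_block (hm : ∀ k, 2 ≤ m k) {μ : Measure (Gm m)} (hμ : IsHaar m μ)
    {f : ℕ → Gm m → ℂ} (hf : IsMartingale m μ f) {j A n a : ℕ} (hA : M m n = M m j * A)
    (ha : a < A) (x : Gm m) :
    ‖∑ i ∈ range (M m j), coeff m μ f (i + M m j * a) * vil m (i + M m j * a) x‖ₑ =
      (A : ℝ≥0∞)⁻¹ * ‖∑ l ∈ range (M m n) with l % M m j = idx j x,
        f n (pt m l) * (starRingEnd ℂ) (vil m (M m j * a) (pt m l))‖ₑ := by
  rw [← ofReal_norm, norm_sum_block hm hμ hf hA ha, ENNReal.ofReal_mul (by positivity),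
    ENNReal.ofReal_inv_of_pos (Nat.cast_pos.2 (by omega)), ENNReal.ofReal_natCast, ofReal_norm]

theorem sum_range_mul_div {R : Type*} [Semiring R] {P : ℕ} (hP : 0 < P) (B : ℕ) (φ : ℕ → R) :
    ∑ n ∈ range (P * B), φ (n / P) = P * ∑ b ∈ range B, φ b := by
  rw [sum_range_mul_eq, mul_sum]
  refine sum_congr rfl fun b _ => ?_
  trans ∑ _i ∈ range P, φ b
  · refine sum_congr rfl fun i hi => ?_
    rw [Nat.add_mul_div_left _ _ hP, Nat.div_eq_of_lt (mem_range.1 hi), zero_add]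
  · rw [sum_const, card_range, nsmul_eq_mul]

theorem sum_range_mul_mod {R : Type*} [Semiring R] (P B : ℕ) (φ : ℕ → R) :
    ∑ n ∈ range (P * B), φ (n % P) = B * ∑ r ∈ range P, φ r := by
  rw [sum_range_mul_eq, ← nsmul_eq_mul]
  trans ∑ _b ∈ range B, ∑ r ∈ range P, φ r
  · refine sum_congr rfl fun b _ => sum_congr rfl fun i hi => ?_
    rw [Nat.add_mul_mod_self_left, Nat.mod_eq_of_lt (mem_range.1 hi)]
  · rw [sum_const, card_range]

/-- The `ℓ²`-size, raised to the power `p`, of `f^(n)` on the cylinder of length `j` with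
number `r`. -/
def locSize (p : ℝ) (f : ℕ → Gm m → ℂ) (n j r : ℕ) : ℝ≥0∞ :=
  (∑ l ∈ range (M m n) with l % M m j = r, ‖f n (pt m l)‖ₑ ^ 2) ^ (p / 2)

theorem sum_enorm_block_rpow_le (hm : ∀ k, 2 ≤ m k) {μ : Measure (Gm m)} (hμ : IsHaar m μ)
    {f : ℕ → Gm m → ℂ} (hf : IsMartingale m μ f) {p : ℝ} (hp0 : 0 < p) (hp1 : p < 1)
    {j A n : ℕ} (hA : M m n = M m j * A) (x : Gm m) :
    ∑ a ∈ range A, ‖∑ i ∈ range (M m j),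
        coeff m μ f (i + M m j * a) * vil m (i + M m j * a) x‖ₑ ^ p ≤
      (A : ℝ≥0∞) ^ (1 - p) * locSize p f n j (idx j x) := by
  have hA0 : (A : ℝ≥0∞) ≠ 0 := by
    have := M_pos hm n
    rw [hA] at this
    exact_mod_cast (Nat.pos_of_mul_pos_left this).ne'
  have hAt : (A : ℝ≥0∞) ≠ ⊤ := ENNReal.natCast_ne_top _
  set T : ℕ → ℝ≥0∞ := fun a => ‖∑ l ∈ range (M m n) with l % M m j = idx j x,
        f n (pt m l) * (starRingEnd ℂ) (vil m (M m j * a) (pt m l))‖ₑ with hT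
  calc _ = ∑ a ∈ range A, (A : ℝ≥0∞) ^ (-p) * T a ^ p := by
        refine sum_congr rfl fun a ha => ?_
        rw [enorm_sum_block hm hμ hf hA (mem_range.1 ha), ENNReal.mul_rpow_of_nonneg _ _ hp0.le,
          ENNReal.inv_rpow, ENNReal.rpow_neg]
    _ ≤ (A : ℝ≥0∞) ^ (-p) * ((A : ℝ≥0∞) ^ (1 - p / 2) * (∑ a ∈ range A, T a ^ 2) ^ (p / 2)) := by
        rw [← mul_sum]
        gcongr
        simpa using sum_rpow_le_card_mul (range A) hp0 (by linarith) T
    _ = (A : ℝ≥0∞) ^ (-p) * ((A : ℝ≥0∞) ^ (1 - p / 2) * ((A : ℝ≥0∞) ^ (p / 2) *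
          locSize p f n j (idx j x))) := by
        rw [hT, sum_enorm_sq_coeff hm hA, ENNReal.mul_rpow_of_nonneg _ _ (by positivity), locSize]
    _ = _ := by
        rw [← mul_assoc, ← mul_assoc, ← ENNReal.rpow_add _ _ hA0 hAt,
          ← ENNReal.rpow_add _ _ hA0 hAt]
        congr 2
        ring

theorem enorm_S_rpow_le {μ : Measure (Gm m)} {f : ℕ → Gm m → ℂ} (hm : ∀ k, 2 ≤ m k)
    {p : ℝ} (hp0 : 0 < p) (hp1 : p < 1) {n J : ℕ} (hn : n < M m J) (x : Gm m) :
    ‖S m μ f n x‖ₑ ^ p ≤ ∑ j ∈ range J, ∑ c ∈ range (m j), ‖∑ i ∈ range (M m j),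
      coeff m μ f (i + M m j * (c + m j * (n / M m (j + 1)))) *
        vil m (i + M m j * (c + m j * (n / M m (j + 1)))) x‖ₑ ^ p := by
  rw [S_eq_sum_blocks μ f hn]
  calc _ ≤ (∑ j ∈ range J, ∑ c ∈ range (digit m n j), ‖∑ i ∈ range (M m j),
      coeff m μ f (i + M m j * (c + m j * (n / M m (j + 1)))) *
        vil m (i + M m j * (c + m j * (n / M m (j + 1)))) x‖ₑ) ^ p := by
        refine ENNReal.rpow_le_rpow ((enorm_sum_le _ _).trans ?_) hp0.le
        exact sum_le_sum fun j _ => enorm_sum_le _ _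
    _ ≤ _ := by
        refine (rpow_sum_le_sum_rpow _ _ hp0 hp1.le).trans (sum_le_sum fun j _ => ?_)
        refine (rpow_sum_le_sum_rpow _ _ hp0 hp1.le).trans ?_
        exact sum_le_sum_of_subset (range_subset_range.2 (digit_lt hm n j).le)

theorem sum_sum_sum_comm {R : Type*} [AddCommMonoid R] (s t u : Finset ℕ) (F : ℕ → ℕ → ℕ → R) :
    ∑ n ∈ s, ∑ y ∈ t, ∑ j ∈ u, F n y j = ∑ j ∈ u, ∑ y ∈ t, ∑ n ∈ s, F n y j := by
  rw [sum_comm, sum_comm (s := u)]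
  exact sum_congr rfl fun y _ => sum_comm

theorem sum_lintegral_S_le (hm : ∀ k, 2 ≤ m k) {lam : ℕ} (hlam : ∀ k, m k ≤ lam)
    {μ : Measure (Gm m)} (hμ : IsHaar m μ) {f : ℕ → Gm m → ℂ} (hf : IsMartingale m μ f) {p : ℝ}
    (hp0 : 0 < p) (hp1 : p < 1) (J : ℕ) :
    ∑ n ∈ range (M m J), ∫⁻ x, ‖S m μ f n x‖ₑ ^ p ∂μ ≤
      ∑ j ∈ range J, lam * ((M m J : ℝ≥0∞) ^ (1 - p) * ((M m j : ℝ≥0∞) ^ (p - 1) *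
        ∑ r ∈ range (M m j), locSize p f J j r)) := by
  have hJ0 : (M m J : ℝ≥0∞) ≠ 0 := by exact_mod_cast (M_pos hm _).ne'
  have hJt : (M m J : ℝ≥0∞) ≠ ⊤ := ENNReal.natCast_ne_top _
  set B : ℕ → ℕ → ℕ → ℝ≥0∞ := fun j y a => ‖∑ i ∈ range (M m j),
      coeff m μ f (i + M m j * a) * vil m (i + M m j * a) (pt m y)‖ₑ ^ p with hB
  have hblock : ∀ j ∈ range J, ∑ y ∈ range (M m J), ∑ n ∈ range (M m J), ∑ c ∈ range (m j),
      B j y (c + m j * (n / M m (j + 1))) ≤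
      M m J * (lam * ((M m J : ℝ≥0∞) ^ (1 - p) * ((M m j : ℝ≥0∞) ^ (p - 1) *
        ∑ r ∈ range (M m j), locSize p f J j r))) := by
    intro j hj
    have hj := mem_range.1 hj
    have hj0 : (M m j : ℝ≥0∞) ≠ 0 := by exact_mod_cast (M_pos hm _).ne'
    have hjt : (M m j : ℝ≥0∞) ≠ ⊤ := ENNReal.natCast_ne_top _
    obtain ⟨D, hD⟩ := M_dvd (m := m) (Nat.succ_le_of_lt hj)
    have hA : M m J = M m j * (m j * D) := by rw [hD, M_succ, mul_assoc]
    have hAcast : (M m J : ℝ≥0∞) * (M m j : ℝ≥0∞)⁻¹ = ((m j * D : ℕ) : ℝ≥0∞) := by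
      rw [hA, Nat.cast_mul, mul_comm, ← mul_assoc, ENNReal.inv_mul_cancel hj0 hjt, one_mul]
    calc _ = ∑ y ∈ range (M m J), (M m (j + 1) : ℝ≥0∞) * ∑ a ∈ range (m j * D), B j y a := by
          refine sum_congr rfl fun y _ => ?_
          rw [hD, sum_range_mul_div (M_pos hm _) D
            (fun b => ∑ c ∈ range (m j), B j y (c + m j * b)), sum_range_mul_eq]
      _ ≤ ∑ y ∈ range (M m J), (M m (j + 1) : ℝ≥0∞) *
            (((m j * D : ℕ) : ℝ≥0∞) ^ (1 - p) * locSize p f J j (y % M m j)) := by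
          gcongr with y
          rw [← idx_pt hm]
          exact sum_enorm_block_rpow_le hm hμ hf hp0 hp1 hA _
      _ = (M m (j + 1) : ℝ≥0∞) * (((m j * D : ℕ) : ℝ≥0∞) ^ (1 - p) * (((m j * D : ℕ) : ℝ≥0∞) *
            ∑ r ∈ range (M m j), locSize p f J j r)) := by
          rw [← mul_sum, ← mul_sum]
          congr 2
          rw [← sum_range_mul_mod, ← hA]
      _ = (M m J : ℝ≥0∞) * (m j * (((m j * D : ℕ) : ℝ≥0∞) ^ (1 - p) *
            ∑ r ∈ range (M m j), locSize p f J j r)) := by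
          rw [hA, M_succ]
          push_cast
          ring
      _ ≤ (M m J : ℝ≥0∞) * (lam * (((m j * D : ℕ) : ℝ≥0∞) ^ (1 - p) *
            ∑ r ∈ range (M m j), locSize p f J j r)) := by
          gcongr
          exact hlam j
      _ = _ := by
          rw [← hAcast, ENNReal.mul_rpow_of_nonneg _ _ (by linarith), ENNReal.inv_rpow,
            ← ENNReal.rpow_neg, neg_sub, mul_assoc ((M m J : ℝ≥0∞) ^ (1 - p))]
  calc ∑ n ∈ range (M m J), ∫⁻ x, ‖S m μ f n x‖ₑ ^ p ∂μ
      = ∑ n ∈ range (M m J), (M m J : ℝ≥0∞)⁻¹ * ∑ y ∈ range (M m J), ‖S m μ f n (pt m y)‖ₑ ^ p := by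
        refine sum_congr rfl fun n hn => ?_
        refine lintegral_eq_sum_of_dep hm hμ fun x y h => ?_
        have : S m μ f n x = S m μ f n y := by
          rw [S, S]
          refine sum_congr rfl fun k hk => ?_
          rw [vil_congr hm ((mem_range.1 hk).trans (mem_range.1 hn)) h]
        rw [this]
    _ ≤ ∑ n ∈ range (M m J), (M m J : ℝ≥0∞)⁻¹ * ∑ y ∈ range (M m J), ∑ j ∈ range J,
          ∑ c ∈ range (m j), B j y (c + m j * (n / M m (j + 1))) := by
        gcongr with n hn y
        exact enorm_S_rpow_le hm hp0 hp1 (mem_range.1 hn) _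
    _ = (M m J : ℝ≥0∞)⁻¹ * ∑ j ∈ range J, ∑ y ∈ range (M m J), ∑ n ∈ range (M m J),
          ∑ c ∈ range (m j), B j y (c + m j * (n / M m (j + 1))) := by
        rw [← mul_sum, sum_sum_sum_comm]
    _ ≤ (M m J : ℝ≥0∞)⁻¹ * ∑ j ∈ range J, M m J * (lam * ((M m J : ℝ≥0∞) ^ (1 - p) *
          ((M m j : ℝ≥0∞) ^ (p - 1) * ∑ r ∈ range (M m j), locSize p f J j r))) := by
        gcongr with j hj
        exact hblock j hj
    _ = _ := by
        rw [← mul_sum, ← mul_assoc, ENNReal.inv_mul_cancel hJ0 hJt, one_mul]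

theorem aemeasurable_mstar {μ : Measure (Gm m)} {f : ℕ → Gm m → ℂ} (hf : IsMartingale m μ f) :
    AEMeasurable (mstar m f) μ :=
  AEMeasurable.iSup fun n => (hf.integrable n).aestronglyMeasurable.enorm

theorem tsum_locSize_le (hm : ∀ k, 2 ≤ m k) {μ : Measure (Gm m)} (hμ : IsHaar m μ)
    {f : ℕ → Gm m → ℂ} (hf : IsMartingale m μ f) {p : ℝ} (hp0 : 0 < p) (hp1 : p < 1)
    {j r : ℕ} (hr : r < M m j) :
    ∑' N, (if j < N then (M m N : ℝ≥0∞)⁻¹ * locSize p f N j r else 0) ≤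
      4 * (1 - (2 : ℝ≥0∞) ^ (p / 2 - 1))⁻¹ *
        ∫⁻ x in cylAt m j (pt m r), mstar m f x ^ p ∂μ := by
  have hq : 1 < 2 / p := (one_lt_div hp0).2 (by linarith)
  have h := tsum_level_le hm hμ hq
    (U := (cylAt m j (pt m r)).indicator fun x => mstar m f x ^ p)
    (u := fun N i => if j < N ∧ i % M m j = r then ‖f N (pt m i)‖ₑ ^ p else 0)
    (((aemeasurable_mstar hf).pow_const p).indicator (measurableSet_cylAt j _)) ?_ ?_
  · rw [lintegral_indicator (measurableSet_cylAt j _), inv_div] at h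
    refine le_trans (ENNReal.tsum_le_tsum fun N => ?_) h
    split_ifs with hN
    · simp only [hN, true_and]
      rw [locSize, sum_filter]
      gcongr with i
      split_ifs
      · rw [← ENNReal.rpow_mul, mul_div_cancel₀ _ hp0.ne', ENNReal.rpow_two]
      · exact zero_le
    · exact zero_le
  · intro N i
    split_ifs
    · exact ENNReal.rpow_ne_top_of_nonneg hp0.le enorm_ne_top
    · exact ENNReal.zero_ne_top
  · intro N i hi x hx
    split_ifs with h
    · have hx' : ∀ k < N, x k = pt m i k := hx
      have hxj : x ∈ cylAt m j (pt m r) := by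
        rw [mem_cylAt_pt hm hr, ← h.2, ← idx_pt hm]
        exact (idx_eq_iff hm).2 fun k hk => hx' k (hk.trans h.1)
      rw [Set.indicator_of_mem hxj, ← hf.adapted N x _ hx']
      gcongr
      exact le_iSup (fun n => (‖f n x‖₊ : ℝ≥0∞)) N
    · exact zero_le

theorem tsum_sum_locSize_le (hm : ∀ k, 2 ≤ m k) {μ : Measure (Gm m)} (hμ : IsHaar m μ)
    {f : ℕ → Gm m → ℂ} (hf : IsMartingale m μ f) {p : ℝ} (hp0 : 0 < p) (hp1 : p < 1) (j : ℕ) :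
    ∑' N, (if j < N then (M m N : ℝ≥0∞)⁻¹ * ∑ r ∈ range (M m j), locSize p f N j r else 0) ≤
      4 * (1 - (2 : ℝ≥0∞) ^ (p / 2 - 1))⁻¹ * ∫⁻ x, mstar m f x ^ p ∂μ := by
  calc _ = ∑ r ∈ range (M m j),
        ∑' N, (if j < N then (M m N : ℝ≥0∞)⁻¹ * locSize p f N j r else 0) := by
        rw [← Summable.tsum_finsetSum fun _ _ => ENNReal.summable]
        refine tsum_congr fun N => ?_
        split_ifs
        · rw [mul_sum]
        · simp
    _ ≤ ∑ r ∈ range (M m j), 4 * (1 - (2 : ℝ≥0∞) ^ (p / 2 - 1))⁻¹ *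
          ∫⁻ x in cylAt m j (pt m r), mstar m f x ^ p ∂μ :=
        sum_le_sum fun r hr => tsum_locSize_le hm hμ hf hp0 hp1 (mem_range.1 hr)
    _ = _ := by rw [← mul_sum, ← lintegral_eq_sum_cylAt hm μ j]

theorem exists_M_le_lt (hm : ∀ k, 2 ≤ m k) {n : ℕ} (hn : 1 ≤ n) :
    ∃ N, M m N ≤ n ∧ n < M m (N + 1) := by
  classical
  have hex : ∃ N, n < M m N := ⟨n, lt_M hm n⟩
  have h0 : Nat.find hex ≠ 0 := fun h => by
    have := Nat.find_spec hex
    rw [h] at this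
    exact absurd this (not_lt.2 hn)
  obtain ⟨N, hN⟩ := Nat.exists_eq_succ_of_ne_zero h0
  exact ⟨N, not_lt.1 (Nat.find_min hex (by omega)), by simpa [hN] using Nat.find_spec hex⟩

theorem tsum_div_rpow_le (hm : ∀ k, 2 ≤ m k) {lam : ℕ} (hlam : ∀ k, m k ≤ lam) {t : ℝ}
    (ht : 0 ≤ t) (b : ℕ → ℝ≥0∞) :
    ∑' k : ℕ, b (k + 1) / ((k + 1 : ℕ) : ℝ≥0∞) ^ t ≤
      ∑' N : ℕ, (lam : ℝ≥0∞) ^ t * ((M m (N + 1) : ℝ≥0∞) ^ (-t) *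
        ∑ n ∈ range (M m (N + 1)), b n) := by
  classical
  calc ∑' k : ℕ, b (k + 1) / ((k + 1 : ℕ) : ℝ≥0∞) ^ t
      ≤ ∑' k : ℕ, ∑' N : ℕ, (if M m N ≤ k + 1 ∧ k + 1 < M m (N + 1) then
          b (k + 1) / ((k + 1 : ℕ) : ℝ≥0∞) ^ t else 0) := by
        refine ENNReal.tsum_le_tsum fun k => ?_
        obtain ⟨N, hN⟩ := exists_M_le_lt hm (Nat.le_add_left 1 k)
        refine le_trans ?_ (ENNReal.le_tsum N)
        rw [if_pos hN]
    _ = ∑' N : ℕ, ∑' k : ℕ, (if M m N ≤ k + 1 ∧ k + 1 < M m (N + 1) then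
          b (k + 1) / ((k + 1 : ℕ) : ℝ≥0∞) ^ t else 0) := ENNReal.tsum_comm
    _ ≤ ∑' N : ℕ, ∑' n : ℕ, (if M m N ≤ n ∧ n < M m (N + 1) then
          b n / (n : ℝ≥0∞) ^ t else 0) := by
        refine ENNReal.tsum_le_tsum fun N => ?_
        exact ENNReal.tsum_comp_le_tsum_of_injective (add_left_injective 1)
          (fun n : ℕ => if M m N ≤ n ∧ n < M m (N + 1) then b n / (n : ℝ≥0∞) ^ t else 0)
    _ ≤ _ := by
        refine ENNReal.tsum_le_tsum fun N => ?_
        rw [tsum_eq_sum (s := range (M m (N + 1))) fun n hn => if_neg fun h => hn (by simpa using h.2),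
          mul_sum, mul_sum]
        refine sum_le_sum fun n _ => ?_
        split_ifs with h
        · have hlam0 : (lam : ℝ≥0∞) ≠ 0 := by
            have := (hm 0).trans (hlam 0)
            exact_mod_cast (by omega : lam ≠ 0)
          have hle : (M m (N + 1) : ℝ≥0∞) ≤ lam * n := by
            rw [M_succ, mul_comm]
            exact_mod_cast Nat.mul_le_mul (hlam N) h.1
          have h1 : (lam : ℝ≥0∞) ^ t * (lam : ℝ≥0∞) ^ (-t) = 1 := by
            rw [← ENNReal.rpow_add _ _ hlam0 (ENNReal.natCast_ne_top _), add_neg_cancel,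
              ENNReal.rpow_zero]
          calc b n / (n : ℝ≥0∞) ^ t
              = (lam : ℝ≥0∞) ^ t * ((lam * n : ℝ≥0∞) ^ (-t) * b n) := by
                rw [ENNReal.mul_rpow_of_ne_top (ENNReal.natCast_ne_top _)
                  (ENNReal.natCast_ne_top _), ← mul_assoc, ← mul_assoc, h1, one_mul,
                  ENNReal.rpow_neg, ENNReal.div_eq_inv_mul]
            _ ≤ _ := by
                refine mul_le_mul' le_rfl (mul_le_mul' ?_ le_rfl)
                rw [ENNReal.rpow_neg, ENNReal.rpow_neg, ENNReal.inv_le_inv]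
                exact ENNReal.rpow_le_rpow hle ht
        · exact zero_le

theorem tsum_M_rpow_le (hm : ∀ k, 2 ≤ m k) {p : ℝ} (hp1 : p < 1) :
    ∑' j, (M m j : ℝ≥0∞) ^ (p - 1) ≤ (1 - (2 : ℝ≥0∞) ^ (p - 1))⁻¹ := by
  rw [← ENNReal.tsum_geometric]
  refine ENNReal.tsum_le_tsum fun j => ?_
  rw [← ENNReal.rpow_natCast, ← ENNReal.rpow_mul, mul_comm (p - 1), ENNReal.rpow_mul,
    ENNReal.rpow_natCast, ← neg_sub, ENNReal.rpow_neg, ENNReal.rpow_neg, ENNReal.inv_le_inv]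
  refine ENNReal.rpow_le_rpow ?_ (by linarith)
  exact_mod_cast two_pow_le_M hm j

theorem tsum_lintegral_S_le (hm : ∀ k, 2 ≤ m k) {lam : ℕ} (hlam : ∀ k, m k ≤ lam)
    {μ : Measure (Gm m)} (hμ : IsHaar m μ) {f : ℕ → Gm m → ℂ} (hf : IsMartingale m μ f) {p : ℝ}
    (hp0 : 0 < p) (hp1 : p < 1) :
    ∑' k : ℕ, (∫⁻ x, ‖S m μ f (k + 1) x‖ₑ ^ p ∂μ) / ((k + 1 : ℕ) : ℝ≥0∞) ^ (2 - p) ≤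
      (lam : ℝ≥0∞) ^ (2 - p) * (lam * ((1 - (2 : ℝ≥0∞) ^ (p - 1))⁻¹ *
        (4 * (1 - (2 : ℝ≥0∞) ^ (p / 2 - 1))⁻¹))) * ∫⁻ x, mstar m f x ^ p ∂μ := by
  calc _ ≤ ∑' N : ℕ, (lam : ℝ≥0∞) ^ (2 - p) * ((M m (N + 1) : ℝ≥0∞) ^ (-(2 - p)) *
        ∑ n ∈ range (M m (N + 1)), ∫⁻ x, ‖S m μ f n x‖ₑ ^ p ∂μ) :=
        tsum_div_rpow_le hm hlam (by linarith) fun n => ∫⁻ x, ‖S m μ f n x‖ₑ ^ p ∂μ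
    _ ≤ ∑' J : ℕ, (lam : ℝ≥0∞) ^ (2 - p) * ((M m J : ℝ≥0∞) ^ (-(2 - p)) *
        ∑ n ∈ range (M m J), ∫⁻ x, ‖S m μ f n x‖ₑ ^ p ∂μ) :=
        ENNReal.tsum_comp_le_tsum_of_injective (add_left_injective 1)
          (fun J : ℕ => (lam : ℝ≥0∞) ^ (2 - p) * ((M m J : ℝ≥0∞) ^ (-(2 - p)) *
            ∑ n ∈ range (M m J), ∫⁻ x, ‖S m μ f n x‖ₑ ^ p ∂μ))
    _ ≤ ∑' J : ℕ, (lam : ℝ≥0∞) ^ (2 - p) * (lam * ∑' j, (M m j : ℝ≥0∞) ^ (p - 1) *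
          (if j < J then (M m J : ℝ≥0∞)⁻¹ * ∑ r ∈ range (M m j), locSize p f J j r else 0)) := by
        refine ENNReal.tsum_le_tsum fun J => ?_
        refine mul_le_mul' le_rfl ?_
        have hJ : (M m J : ℝ≥0∞) ^ (-(2 - p)) * (M m J : ℝ≥0∞) ^ (1 - p) = (M m J : ℝ≥0∞)⁻¹ := by
          rw [← ENNReal.rpow_add _ _ (by exact_mod_cast (M_pos hm J).ne')
            (ENNReal.natCast_ne_top _), ← ENNReal.rpow_neg_one]
          congr 1
          ring
        calc _ ≤ (M m J : ℝ≥0∞) ^ (-(2 - p)) * ∑ j ∈ range J, lam * ((M m J : ℝ≥0∞) ^ (1 - p) *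
              ((M m j : ℝ≥0∞) ^ (p - 1) * ∑ r ∈ range (M m j), locSize p f J j r)) := by
              gcongr
              exact sum_lintegral_S_le hm hlam hμ hf hp0 hp1 J
          _ = lam * ∑ j ∈ range J, (M m j : ℝ≥0∞) ^ (p - 1) *
              (if j < J then (M m J : ℝ≥0∞)⁻¹ * ∑ r ∈ range (M m j), locSize p f J j r else 0) := by
              rw [mul_sum, mul_sum]
              refine sum_congr rfl fun j hj => ?_
              rw [if_pos (mem_range.1 hj), ← hJ]
              ring
          _ ≤ _ := by
              gcongr
              exact ENNReal.sum_le_tsum _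
    _ = (lam : ℝ≥0∞) ^ (2 - p) * (lam * ∑' j, (M m j : ℝ≥0∞) ^ (p - 1) * ∑' J : ℕ,
          (if j < J then (M m J : ℝ≥0∞)⁻¹ * ∑ r ∈ range (M m j), locSize p f J j r else 0)) := by
        rw [ENNReal.tsum_mul_left, ENNReal.tsum_mul_left, ENNReal.tsum_comm]
        simp_rw [ENNReal.tsum_mul_left]
    _ ≤ (lam : ℝ≥0∞) ^ (2 - p) * (lam * ∑' j, (M m j : ℝ≥0∞) ^ (p - 1) *
          (4 * (1 - (2 : ℝ≥0∞) ^ (p / 2 - 1))⁻¹ * ∫⁻ x, mstar m f x ^ p ∂μ)) := by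
        gcongr with j
        exact tsum_sum_locSize_le hm hμ hf hp0 hp1 j
    _ ≤ (lam : ℝ≥0∞) ^ (2 - p) * (lam * ((1 - (2 : ℝ≥0∞) ^ (p - 1))⁻¹ *
          (4 * (1 - (2 : ℝ≥0∞) ^ (p / 2 - 1))⁻¹ * ∫⁻ x, mstar m f x ^ p ∂μ))) := by
        rw [ENNReal.tsum_mul_right]
        gcongr
        exact tsum_M_rpow_le hm hp1
    _ = _ := by ring

theorem inv_one_sub_two_rpow_ne_top {t : ℝ} (ht : t < 0) :
    (1 - (2 : ℝ≥0∞) ^ t)⁻¹ ≠ ⊤ := by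
  rw [ENNReal.inv_ne_top, ← pos_iff_ne_zero, tsub_pos_iff_lt]
  exact ENNReal.rpow_lt_one_of_one_lt_of_neg (by norm_num) ht

end Vilenkin

/-- strong convergence of partial sums: for `0 < p < 1` there is
`c_p > 0` (depending only on `p` and `λ = sup m_k`) with
`∑_{k=1}^∞ ‖S_k f‖_{L_p}^p / k^{2-p} ≤ c_p ‖f‖_{H_p}^p` for every martingale
`f ∈ H_p`. -/
theorem statement12 (p : ℝ) (hp0 : 0 < p) (hp1 : p < 1) (lam : ℕ) :
    ∃ c : ℝ, 0 < c ∧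
      ∀ (m : ℕ → ℕ), (∀ k, 2 ≤ m k) → (∀ k, m k ≤ lam) →
      ∀ (μ : Measure (Gm m)), Vilenkin.IsHaar m μ →
      ∀ (f : ℕ → Gm m → ℂ), Vilenkin.IsMartingale m μ f → Vilenkin.MemHp m μ p f →
        ∑' k : ℕ,
            (∫⁻ x, (‖Vilenkin.S m μ f (k + 1) x‖₊ : ℝ≥0∞) ^ p ∂μ) /
              ((k + 1 : ℕ) : ℝ≥0∞) ^ (2 - p) ≤
          ENNReal.ofReal c * ∫⁻ x, Vilenkin.mstar m f x ^ p ∂μ := by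
  set C : ℝ≥0∞ := (lam : ℝ≥0∞) ^ (2 - p) * (lam * ((1 - (2 : ℝ≥0∞) ^ (p - 1))⁻¹ *
    (4 * (1 - (2 : ℝ≥0∞) ^ (p / 2 - 1))⁻¹))) with hC
  have hCt : C ≠ ⊤ := by
    have h1 := Vilenkin.inv_one_sub_two_rpow_ne_top (t := p - 1) (by linarith)
    have h2 := Vilenkin.inv_one_sub_two_rpow_ne_top (t := p / 2 - 1) (by linarith)
    have h3 : (lam : ℝ≥0∞) ^ (2 - p) ≠ ⊤ :=
      ENNReal.rpow_ne_top_of_nonneg (by linarith) (ENNReal.natCast_ne_top _)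
    exact ENNReal.mul_ne_top h3 (ENNReal.mul_ne_top (ENNReal.natCast_ne_top _)
      (ENNReal.mul_ne_top h1 (ENNReal.mul_ne_top (by norm_num) h2)))
  refine ⟨C.toReal + 1, by positivity, fun m hm hlam μ hμ f hf _ => ?_⟩
  refine (Vilenkin.tsum_lintegral_S_le hm hlam hμ hf hp0 hp1).trans ?_
  gcongr
  exact (ENNReal.ofReal_toReal hCt).symm.le.trans (ENNReal.ofReal_le_ofReal (by linarith))
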